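/- Let α ∈ R_h and let K = {(x,y) ∈ P : x² + y² ≤ x₀² + y₀²}. Then there exists β ∈ R_h such that β(t) ∈ K for all t ∈ [0,1) and λ_{1,p}(β) ≥ λ_{1,p}(α) for all p ≥ 2n−1. -/

import Mathlib

open Set MeasureTheory Filter Topology

noncomputable section

/-- The closed quarter plane `P`. -/
def Pset : Set (ℝ × ℝ) := {z | 0 ≤ z.1 ∧ 0 ≤ z.2}

/-- The interior `P°` of the quarter plane. -/
def Pint : Set (ℝ × ℝ) := {z | 0 < z.1 ∧ 0 < z.2}

/-- The boundary `∂P` of the quarter plane. -/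
def Pbdry : Set (ℝ × ℝ) := {z | (0 ≤ z.1 ∧ 0 ≤ z.2) ∧ (z.1 = 0 ∨ z.2 = 0)}

/-- `F(x,y) = c_n x^(n-1) y^(n-1)`. -/
def Fvol (n : ℕ) (cn : ℝ) (z : ℝ × ℝ) : ℝ := cn * z.1 ^ (n - 1) * z.2 ^ (n - 1)

/-- Euclidean speed of a curve at `t`, computed with derivatives within `s`. -/
def gSpeedOn (s : Set ℝ) (α : ℝ → ℝ × ℝ) (t : ℝ) : ℝ :=
  Real.sqrt ((derivWithin (fun u => (α u).1) s t) ^ 2 + (derivWithin (fun u => (α u).2) s t) ^ 2)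

/-- Euclidean speed of a curve defined on `[0,1]`. -/
def gSpeed (α : ℝ → ℝ × ℝ) : ℝ → ℝ := gSpeedOn (Icc 0 1) α

/-- Euclidean length `L_g` of a curve on `[0,1]`. -/
def Lg (α : ℝ → ℝ × ℝ) : ℝ := ∫ t in (0:ℝ)..1, gSpeed α t

/-- The `h`-speed `|γ'|_h = F(γ) |γ'|_g`, with derivatives within `s`. -/
def hSpeedOn (n : ℕ) (cn : ℝ) (s : Set ℝ) (α : ℝ → ℝ × ℝ) (t : ℝ) : ℝ :=
  Fvol n cn (α t) * gSpeedOn s α t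

/-- The `h`-speed for curves defined on `[0,1)`. -/
def hSpeed (n : ℕ) (cn : ℝ) (α : ℝ → ℝ × ℝ) : ℝ → ℝ := hSpeedOn n cn (Ico 0 1) α

/-- The `h`-length `L_h` of a curve on `[0,1)`. -/
def Lh (n : ℕ) (cn : ℝ) (α : ℝ → ℝ × ℝ) : ℝ := ∫ t in (0:ℝ)..1, hSpeed n cn α t

/-- Numerator integrand of the `g`-Rayleigh quotient:
`|w'(t)|^p F(α t) |α'(t)|_g^(1-p)`. -/
def numG (n : ℕ) (cn p : ℝ) (s : Set ℝ) (α : ℝ → ℝ × ℝ) (w : ℝ → ℝ) (t : ℝ) : ℝ :=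
  |derivWithin w (Icc 0 1) t| ^ p * Fvol n cn (α t) * gSpeedOn s α t ^ (1 - p)

/-- Denominator integrand of the `g`-Rayleigh quotient:
`|w(t)|^p F(α t) |α'(t)|_g`. -/
def denG (n : ℕ) (cn p : ℝ) (s : Set ℝ) (α : ℝ → ℝ × ℝ) (w : ℝ → ℝ) (t : ℝ) : ℝ :=
  |w t| ^ p * Fvol n cn (α t) * gSpeedOn s α t

/-- First Dirichlet eigenvalue of the `p`-Laplacian along a curve, `g`-form:
infimum of the Rayleigh quotient over Lipschitz test functions on `[0,1]`
vanishing at `0` (with admissible, i.e. integrable with positive denominator,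
Rayleigh quotients). -/
def lambdaGOn (n : ℕ) (cn p : ℝ) (s : Set ℝ) (α : ℝ → ℝ × ℝ) : ℝ :=
  sInf {q | ∃ w : ℝ → ℝ, (∃ K, LipschitzOnWith K w (Icc 0 1)) ∧ w 0 = 0 ∧
    IntervalIntegrable (numG n cn p s α w) volume 0 1 ∧
    IntervalIntegrable (denG n cn p s α w) volume 0 1 ∧
    (0 < ∫ t in (0:ℝ)..1, denG n cn p s α w t) ∧
    q = (∫ t in (0:ℝ)..1, numG n cn p s α w t) / (∫ t in (0:ℝ)..1, denG n cn p s α w t)}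

/-- `λ_{1,p}` in the `g`-form for curves on `[0,1]`. -/
def lambdaG (n : ℕ) (cn p : ℝ) (α : ℝ → ℝ × ℝ) : ℝ := lambdaGOn n cn p (Icc 0 1) α

/-- Numerator integrand of the `h`-Rayleigh quotient on `[c,d]`:
`|w'(t)|^p F(γ t)^p |γ'(t)|_h^(1-p)`. -/
def numH (n : ℕ) (cn p c d : ℝ) (s : Set ℝ) (γ : ℝ → ℝ × ℝ) (w : ℝ → ℝ) (t : ℝ) : ℝ :=
  |derivWithin w (Icc c d) t| ^ p * Fvol n cn (γ t) ^ p * hSpeedOn n cn s γ t ^ (1 - p)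

/-- Denominator integrand of the `h`-Rayleigh quotient: `|w(t)|^p |γ'(t)|_h`. -/
def denH (n : ℕ) (cn p : ℝ) (s : Set ℝ) (γ : ℝ → ℝ × ℝ) (w : ℝ → ℝ) (t : ℝ) : ℝ :=
  |w t| ^ p * hSpeedOn n cn s γ t

/-- `λ_{1,p}` in the `h`-form for a curve on `[c,d)`, with test functions
Lipschitz on `[c,d]` vanishing at `c`. -/
def lambdaHOn (n : ℕ) (cn p c d : ℝ) (s : Set ℝ) (γ : ℝ → ℝ × ℝ) : ℝ :=
  sInf {q | ∃ w : ℝ → ℝ, (∃ K, LipschitzOnWith K w (Icc c d)) ∧ w c = 0 ∧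
    IntervalIntegrable (numH n cn p c d s γ w) volume c d ∧
    IntervalIntegrable (denH n cn p s γ w) volume c d ∧
    (0 < ∫ t in c..d, denH n cn p s γ w t) ∧
    q = (∫ t in c..d, numH n cn p c d s γ w t) / (∫ t in c..d, denH n cn p s γ w t)}

/-- `λ_{1,p}` in the `h`-form for curves on `[0,1)`. -/
def lambdaH (n : ℕ) (cn p : ℝ) (γ : ℝ → ℝ × ℝ) : ℝ :=
  lambdaHOn n cn p 0 1 (Ico 0 1) γ

/-- The class `𝒞` of `C¹` curves from `(x₀,y₀)` to the boundary, with constant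
speed, interior image on `[0,1)`, endpoint away from the origin, and meeting the
boundary orthogonally. -/
def MemC (x0 y0 : ℝ) (α : ℝ → ℝ × ℝ) : Prop :=
  ContDiffOn ℝ 1 α (Icc 0 1) ∧
  α 0 = (x0, y0) ∧
  (∀ t ∈ Ico (0:ℝ) 1, α t ∈ Pint) ∧
  α 1 ∈ Pbdry ∧ α 1 ≠ ((0 : ℝ), (0 : ℝ)) ∧
  (∀ t ∈ Icc (0:ℝ) 1, gSpeed α t = Lg α) ∧
  ((α 1).1 = 0 → derivWithin (fun u => (α u).2) (Icc 0 1) 1 = 0) ∧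
  ((α 1).2 = 0 → derivWithin (fun u => (α u).1) (Icc 0 1) 1 = 0)

/-- The Simons cone curve `σ(t) = (1-t)·(R,R)`. -/
def simonsCurve (R : ℝ) : ℝ → ℝ × ℝ := fun t => ((1 - t) * R, (1 - t) * R)

/-- The class `R_h`: locally Lipschitz curves on `[0,1)` with image in `P°`,
starting at `(x₀,y₀)`, with essentially bounded `h`-speed, reaching the collapsed
boundary point as `t → 1` (i.e. `x(γ t)·y(γ t) → 0`). -/
def MemRh (n : ℕ) (cn x0 y0 : ℝ) (γ : ℝ → ℝ × ℝ) : Prop :=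
  γ 0 = (x0, y0) ∧
  (∀ t ∈ Ico (0:ℝ) 1, γ t ∈ Pint) ∧
  (∀ a ∈ Ico (0:ℝ) 1, ∃ K, LipschitzOnWith K γ (Icc 0 a)) ∧
  (∃ M : ℝ, ∀ᵐ t ∂(volume : Measure ℝ), t ∈ Ico (0:ℝ) 1 → hSpeed n cn γ t ≤ M) ∧
  Tendsto (fun t => (γ t).1 * (γ t).2) (𝓝[<] (1:ℝ)) (𝓝 0)

/-- The class `R_h^+`: continuous curves on `[0,1]` into `P` ending on `∂P`
whose restriction to `[0,1)` belongs to `R_h`. -/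
def MemRhPlus (n : ℕ) (cn x0 y0 : ℝ) (α : ℝ → ℝ × ℝ) : Prop :=
  ContinuousOn α (Icc 0 1) ∧ (∀ t ∈ Icc (0:ℝ) 1, α t ∈ Pset) ∧ α 1 ∈ Pbdry ∧
  MemRh n cn x0 y0 α

/-- The class `R_g`: Lipschitz curves on `[0,1]` from `(x₀,y₀)` to `∂P` with
interior image on `[0,1)`. -/
def MemRg (x0 y0 : ℝ) (α : ℝ → ℝ × ℝ) : Prop :=
  (∃ K, LipschitzOnWith K α (Icc 0 1)) ∧ α 0 = (x0, y0) ∧ α 1 ∈ Pbdry ∧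
  ∀ t ∈ Ico (0:ℝ) 1, α t ∈ Pint

/-- The coordinate `u(x,y) = (x² - y²)/2`. -/
def ucoord (z : ℝ × ℝ) : ℝ := (z.1 ^ 2 - z.2 ^ 2) / 2

/-- The coordinate `v(x,y) = xy`. -/
def vcoord (z : ℝ × ℝ) : ℝ := z.1 * z.2

/-- The coordinate `r = √(u² + v²)`. -/
def rcoord (z : ℝ × ℝ) : ℝ := Real.sqrt (ucoord z ^ 2 + vcoord z ^ 2)

/-- The class `R_g^*`: simple curves in `R_g` with a.e. constant speed,
`u(α(1)) > 0`, and `v(α(t)) ≥ c(1-t)` for some `c > 0`. -/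
def MemRgStar (x0 y0 : ℝ) (α : ℝ → ℝ × ℝ) : Prop :=
  MemRg x0 y0 α ∧ InjOn α (Icc 0 1) ∧
  (∀ᵐ t ∂(volume : Measure ℝ), t ∈ Icc (0:ℝ) 1 → gSpeed α t = Lg α) ∧
  0 < ucoord (α 1) ∧
  ∃ c > (0:ℝ), ∀ t ∈ Icc (0:ℝ) 1, c * (1 - t) ≤ vcoord (α t)

/-- The conformal factor of the map folding the plane into the disc of radius `√S`:
`1` inside the disc and `S / |z|²` outside. -/
def foldFactor (S : ℝ) (z : ℝ × ℝ) : ℝ := S / max S (z.1 ^ 2 + z.2 ^ 2)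

/-- The map folding the plane into the disc of radius `√S`: the identity inside the disc and
inversion in its boundary circle outside. -/
def discFold (S : ℝ) (z : ℝ × ℝ) : ℝ × ℝ := (foldFactor S z * z.1, foldFactor S z * z.2)

section Fold

variable {S : ℝ}

lemma foldFactor_pos (hS : 0 < S) (z : ℝ × ℝ) : 0 < foldFactor S z :=
  div_pos hS (lt_max_of_lt_left hS)

lemma foldFactor_le_one (hS : 0 < S) (z : ℝ × ℝ) : foldFactor S z ≤ 1 :=
  (div_le_one (lt_max_of_lt_left hS)).2 (le_max_left _ _)

lemma continuous_foldFactor (hS : 0 < S) : Continuous (foldFactor S) := by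
  unfold foldFactor
  refine continuous_const.div (by fun_prop) fun z => (lt_max_of_lt_left hS).ne'

lemma discFold_of_le (hS : 0 < S) {z : ℝ × ℝ} (hz : z.1 ^ 2 + z.2 ^ 2 ≤ S) :
    discFold S z = z := by
  simp [discFold, foldFactor, max_eq_left hz, hS.ne']

lemma discFold_mem_disc (hS : 0 < S) (z : ℝ × ℝ) :
    (discFold S z).1 ^ 2 + (discFold S z).2 ^ 2 ≤ S := by
  have hN : 0 < max S (z.1 ^ 2 + z.2 ^ 2) := lt_max_of_lt_left hS
  have h1 := le_max_left S (z.1 ^ 2 + z.2 ^ 2)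
  have h2 := le_max_right S (z.1 ^ 2 + z.2 ^ 2)
  simp only [discFold, foldFactor]
  set N := max S (z.1 ^ 2 + z.2 ^ 2)
  have : (S / N * z.1) ^ 2 + (S / N * z.2) ^ 2 = S * (S * (z.1 ^ 2 + z.2 ^ 2)) / N ^ 2 := by
    field_simp
  rw [this, div_le_iff₀ (by positivity)]
  nlinarith [mul_le_mul h1 h2 (by positivity) hN.le]

lemma discFold_mem_Pint (hS : 0 < S) {z : ℝ × ℝ} (hz : z ∈ Pint) : discFold S z ∈ Pint :=
  ⟨mul_pos (foldFactor_pos hS z) hz.1, mul_pos (foldFactor_pos hS z) hz.2⟩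

/-- The folding map does not increase Euclidean distances. -/
lemma discFold_nonexpansive (hS : 0 < S) (a b : ℝ × ℝ) :
    ((discFold S a).1 - (discFold S b).1) ^ 2 + ((discFold S a).2 - (discFold S b).2) ^ 2 ≤
      (a.1 - b.1) ^ 2 + (a.2 - b.2) ^ 2 := by
  wlog hab : a.1 ^ 2 + a.2 ^ 2 ≤ b.1 ^ 2 + b.2 ^ 2 generalizing a b
  · have := this b a (le_of_not_ge hab)
    nlinarith
  have hab2 := add_nonneg (sq_nonneg (a.1 - b.1)) (sq_nonneg (a.2 - b.2))
  rcases le_total (b.1 ^ 2 + b.2 ^ 2) S with hb | hb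
  · rw [discFold_of_le hS hb, discFold_of_le hS (hab.trans hb)]
  have hB : 0 < b.1 ^ 2 + b.2 ^ 2 := hS.trans_le hb
  rcases le_total (a.1 ^ 2 + a.2 ^ 2) S with ha | ha
  · rw [discFold_of_le hS ha]
    simp only [discFold, foldFactor, max_eq_right hb]
    set k := S / (b.1 ^ 2 + b.2 ^ 2) with hk
    have hkB : k * (b.1 ^ 2 + b.2 ^ 2) = S := by rw [hk]; field_simp
    have hk1 : k ≤ 1 := by rw [hk, div_le_one hB]; exact hb
    have hdot : 2 * (a.1 * b.1 + a.2 * b.2) ≤ (1 + k) * (b.1 ^ 2 + b.2 ^ 2) := by nlinarith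
    nlinarith [mul_le_mul_of_nonneg_left hdot (sub_nonneg.2 hk1)]
  · have hA : 0 < a.1 ^ 2 + a.2 ^ 2 := hS.trans_le ha
    simp only [discFold, foldFactor, max_eq_right hb, max_eq_right ha]
    have : (S / (a.1 ^ 2 + a.2 ^ 2) * a.1 - S / (b.1 ^ 2 + b.2 ^ 2) * b.1) ^ 2 +
        (S / (a.1 ^ 2 + a.2 ^ 2) * a.2 - S / (b.1 ^ 2 + b.2 ^ 2) * b.2) ^ 2 =
        S ^ 2 / ((a.1 ^ 2 + a.2 ^ 2) * (b.1 ^ 2 + b.2 ^ 2)) *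
          ((a.1 - b.1) ^ 2 + (a.2 - b.2) ^ 2) := by
      field_simp
      ring
    rw [this]
    refine mul_le_of_le_one_left hab2 ((div_le_one (by positivity)).2 ?_)
    nlinarith

/-- On each side of the circle, and between a point of the circle and any other point, the folding
map scales squared Euclidean distances by the product of the conformal factors. -/
lemma discFold_sq_dist (hS : 0 < S) (a b : ℝ × ℝ)
    (h : (a.1 ^ 2 + a.2 ^ 2 ≤ S ∧ b.1 ^ 2 + b.2 ^ 2 ≤ S) ∨
      (S ≤ a.1 ^ 2 + a.2 ^ 2 ∧ S ≤ b.1 ^ 2 + b.2 ^ 2)) :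
    ((discFold S a).1 - (discFold S b).1) ^ 2 + ((discFold S a).2 - (discFold S b).2) ^ 2 =
      foldFactor S a * foldFactor S b * ((a.1 - b.1) ^ 2 + (a.2 - b.2) ^ 2) := by
  rcases h with ⟨ha, hb⟩ | ⟨ha, hb⟩
  · rw [discFold_of_le hS ha, discFold_of_le hS hb]
    simp [foldFactor, max_eq_left ha, max_eq_left hb, hS.ne']
  · have hB : 0 < b.1 ^ 2 + b.2 ^ 2 := hS.trans_le hb
    have hA : 0 < a.1 ^ 2 + a.2 ^ 2 := hS.trans_le ha
    simp only [discFold, foldFactor, max_eq_right hb, max_eq_right ha]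
    field_simp
    ring

lemma lipschitzOnWith_discFold_comp (hS : 0 < S) {K : NNReal} {γ : ℝ → ℝ × ℝ} {s : Set ℝ}
    (h : LipschitzOnWith K γ s) : LipschitzOnWith (2 * K) (fun t => discFold S (γ t)) s := by
  refine LipschitzOnWith.of_dist_le_mul fun a ha b hb => ?_
  have h1 := h.dist_le_mul a ha b hb
  have h2 := discFold_nonexpansive hS (γ a) (γ b)
  rw [Prod.dist_eq, Real.dist_eq, Real.dist_eq] at h1 ⊢
  obtain ⟨h3, h4⟩ := max_le_iff.1 h1
  push_cast
  have h0 : 0 ≤ K * dist a b := by positivity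
  have h5 := sq_le_sq' (by linarith [abs_nonneg ((γ a).1 - (γ b).1)]) h3
  have h6 := sq_le_sq' (by linarith [abs_nonneg ((γ a).2 - (γ b).2)]) h4
  rw [sq_abs] at h5 h6
  refine max_le (abs_le_of_sq_le_sq ?_ (by positivity)) (abs_le_of_sq_le_sq ?_ (by positivity)) <;>
    nlinarith [sq_nonneg ((discFold S (γ a)).1 - (discFold S (γ b)).1),
      sq_nonneg ((discFold S (γ a)).2 - (discFold S (γ b)).2)]

lemma Fvol_discFold (n : ℕ) (cn : ℝ) (z : ℝ × ℝ) :
    Fvol n cn (discFold S z) = foldFactor S z ^ (2 * (n - 1)) * Fvol n cn z := by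
  simp only [Fvol, discFold, mul_pow, two_mul, pow_add]
  ring

end Fold

/-- If squared increments of two plane curves are asymptotically proportional at `t`, then so are
their squared speeds. -/
lemma sq_speed_eq_of_sq_increment {x₁ y₁ x₂ y₂ k : ℝ → ℝ} {t a₁ b₁ a₂ b₂ : ℝ}
    (hx₁ : HasDerivAt x₁ a₁ t) (hy₁ : HasDerivAt y₁ b₁ t)
    (hx₂ : HasDerivAt x₂ a₂ t) (hy₂ : HasDerivAt y₂ b₂ t) (hk : ContinuousAt k t)
    (h : ∀ᶠ u in 𝓝 t, (x₂ u - x₂ t) ^ 2 + (y₂ u - y₂ t) ^ 2 =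
      k u * ((x₁ u - x₁ t) ^ 2 + (y₁ u - y₁ t) ^ 2)) :
    a₂ ^ 2 + b₂ ^ 2 = k t * (a₁ ^ 2 + b₁ ^ 2) := by
  rw [hasDerivAt_iff_tendsto_slope] at hx₁ hy₁ hx₂ hy₂
  have hk' : Tendsto k (𝓝[≠] t) (𝓝 (k t)) := hk.mono_left nhdsWithin_le_nhds
  refine tendsto_nhds_unique ((hx₂.pow 2).add (hy₂.pow 2))
    ((hk'.mul ((hx₁.pow 2).add (hy₁.pow 2))).congr' ?_)
  filter_upwards [nhdsWithin_le_nhds h, self_mem_nhdsWithin] with u hu hut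
  have hne : u - t ≠ 0 := sub_ne_zero.2 hut
  simp only [slope_def_field, div_pow]
  rw [← add_div, ← add_div, hu, mul_div_assoc]

lemma gSpeedOn_Ico_eq {γ : ℝ → ℝ × ℝ} {t : ℝ} (ht : t ∈ Ioo (0 : ℝ) 1) :
    gSpeedOn (Ico 0 1) γ t =
      √((deriv (fun u => (γ u).1) t) ^ 2 + (deriv (fun u => (γ u).2) t) ^ 2) := by
  have h : Ico (0 : ℝ) 1 ∈ 𝓝 t := Ico_mem_nhds ht.1 ht.2
  simp only [gSpeedOn, derivWithin_of_mem_nhds h]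

/-- A curve which is Lipschitz on every `[0,a]`, `a < 1`, is differentiable a.e. in `(0,1)`. -/
lemma ae_differentiableAt_of_locallyLipschitz {γ : ℝ → ℝ × ℝ}
    (h : ∀ a ∈ Ico (0 : ℝ) 1, ∃ K, LipschitzOnWith K γ (Icc 0 a)) :
    ∀ᵐ t, t ∈ Ioo (0 : ℝ) 1 → DifferentiableAt ℝ γ t := by
  have key : ∀ k : ℕ, ∀ᵐ t, t ∈ Icc (0 : ℝ) (1 - 1 / ((k : ℝ) + 1)) →
      DifferentiableWithinAt ℝ γ (Icc 0 (1 - 1 / ((k : ℝ) + 1))) t := fun k => by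
    have h1 : (0 : ℝ) < 1 / ((k : ℝ) + 1) := by positivity
    have h2 : 1 / ((k : ℝ) + 1) ≤ 1 := by
      rw [div_le_one (by positivity)]; linarith [(Nat.cast_nonneg k : (0 : ℝ) ≤ k)]
    obtain ⟨K, hK⟩ := h (1 - 1 / ((k : ℝ) + 1)) ⟨by linarith, by linarith⟩
    exact hK.ae_differentiableWithinAt_of_mem_real
  filter_upwards [ae_all_iff.2 key] with t ht hmem
  obtain ⟨k, hk⟩ := exists_nat_one_div_lt (sub_pos.2 hmem.2)
  have hlt : t < 1 - 1 / ((k : ℝ) + 1) := by linarith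
  exact (ht k ⟨hmem.1.le, hlt.le⟩).differentiableAt (Icc_mem_nhds hmem.1 hlt)

lemma continuousOn_of_locallyLipschitz {γ : ℝ → ℝ × ℝ}
    (h : ∀ a ∈ Ico (0 : ℝ) 1, ∃ K, LipschitzOnWith K γ (Icc 0 a)) :
    ContinuousOn γ (Ico 0 1) := by
  intro t ht
  obtain ⟨a, hta, ha⟩ := exists_between ht.2
  obtain ⟨K, hK⟩ := h a ⟨ht.1.trans hta.le, ha⟩
  refine (hK.continuousOn t ⟨ht.1, hta.le⟩).mono_of_mem_nhdsWithin ?_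
  filter_upwards [self_mem_nhdsWithin, nhdsWithin_le_nhds (Iio_mem_nhds hta)] with u hu hua
  exact ⟨hu.1, le_of_lt hua⟩

/-- Folding a locally Lipschitz curve scales its speed by the conformal factor, a.e. -/
lemma ae_gSpeedOn_discFold {S : ℝ} (hS : 0 < S) {γ : ℝ → ℝ × ℝ}
    (h : ∀ a ∈ Ico (0 : ℝ) 1, ∃ K, LipschitzOnWith K γ (Icc 0 a)) :
    ∀ᵐ t, t ∈ Ioo (0 : ℝ) 1 →
      gSpeedOn (Ico 0 1) (fun u => discFold S (γ u)) t =
        foldFactor S (γ t) * gSpeedOn (Ico 0 1) γ t := by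
  have h' : ∀ a ∈ Ico (0 : ℝ) 1, ∃ K, LipschitzOnWith K (fun u => discFold S (γ u)) (Icc 0 a) :=
    fun a ha => (h a ha).elim fun K hK => ⟨2 * K, lipschitzOnWith_discFold_comp hS hK⟩
  filter_upwards [ae_differentiableAt_of_locallyLipschitz h,
    ae_differentiableAt_of_locallyLipschitz h'] with t h1 h2 ht
  have d1 := h1 ht
  have d2 := h2 ht
  have hc : ContinuousAt γ t := d1.continuousAt
  have hm := foldFactor_pos hS (γ t)
  have key := sq_speed_eq_of_sq_increment d1.fst.hasDerivAt d1.snd.hasDerivAt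
    d2.fst.hasDerivAt d2.snd.hasDerivAt
    (k := fun u => foldFactor S (γ u) * foldFactor S (γ t))
    (((continuous_foldFactor hS).continuousAt.comp hc).mul continuousAt_const) (by
      have hcN : ContinuousAt (fun u => (γ u).1 ^ 2 + (γ u).2 ^ 2) t := by fun_prop
      rcases lt_trichotomy ((γ t).1 ^ 2 + (γ t).2 ^ 2) S with hlt | heq | hgt
      · filter_upwards [hcN.eventually_lt_const hlt] with u hu
        exact discFold_sq_dist hS _ _ (Or.inl ⟨hu.le, hlt.le⟩)
      · refine Eventually.of_forall fun u => discFold_sq_dist hS _ _ ?_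
        rcases le_total ((γ u).1 ^ 2 + (γ u).2 ^ 2) S with hu | hu
        · exact Or.inl ⟨hu, heq.le⟩
        · exact Or.inr ⟨hu, heq.ge⟩
      · filter_upwards [hcN.eventually_const_lt hgt] with u hu
        exact discFold_sq_dist hS _ _ (Or.inr ⟨hu.le, hgt.le⟩))
  rw [gSpeedOn_Ico_eq ht, gSpeedOn_Ico_eq ht, key, Real.sqrt_mul (by positivity),
    Real.sqrt_mul_self hm.le]

section Rayleigh

variable {n : ℕ} {cn p x0 y0 : ℝ} {γ : ℝ → ℝ × ℝ} {w : ℝ → ℝ}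

lemma Fvol_pos (hcn : 0 < cn) {z : ℝ × ℝ} (hz : z ∈ Pint) : 0 < Fvol n cn z :=
  mul_pos (mul_pos hcn (pow_pos hz.1 _)) (pow_pos hz.2 _)

lemma gSpeedOn_nonneg (s : Set ℝ) (γ : ℝ → ℝ × ℝ) (t : ℝ) : 0 ≤ gSpeedOn s γ t :=
  Real.sqrt_nonneg _

lemma MemRh.hSpeedOn_nonneg (hcn : 0 < cn) (h : MemRh n cn x0 y0 γ) {t : ℝ}
    (ht : t ∈ Ioo (0 : ℝ) 1) : 0 ≤ hSpeedOn n cn (Ico 0 1) γ t :=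
  mul_nonneg (Fvol_pos hcn (h.2.1 t ⟨ht.1.le, ht.2⟩)).le (gSpeedOn_nonneg _ _ _)

lemma aemeasurable_gSpeedOn (γ : ℝ → ℝ × ℝ) :
    AEMeasurable (gSpeedOn (Ico 0 1) γ) (volume.restrict (Ioo 0 1)) := by
  refine AEMeasurable.congr (f := fun t =>
    √((deriv (fun u => (γ u).1) t) ^ 2 + (deriv (fun u => (γ u).2) t) ^ 2)) ?_ ?_
  · exact (((measurable_deriv _).pow_const 2).add
      ((measurable_deriv _).pow_const 2)).sqrt.aemeasurable
  · exact ae_restrict_of_forall_mem measurableSet_Ioo fun t ht => (gSpeedOn_Ico_eq ht).symm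

lemma MemRh.aemeasurable_Fvol (h : MemRh n cn x0 y0 γ) :
    AEMeasurable (fun t => Fvol n cn (γ t)) (volume.restrict (Ioo 0 1)) := by
  have hc := (continuousOn_of_locallyLipschitz h.2.2.1).mono Ioo_subset_Ico_self
  refine ContinuousOn.aemeasurable ?_ measurableSet_Ioo
  unfold Fvol
  fun_prop

lemma MemRh.aemeasurable_hSpeedOn (h : MemRh n cn x0 y0 γ) :
    AEMeasurable (hSpeedOn n cn (Ico 0 1) γ) (volume.restrict (Ioo 0 1)) :=
  h.aemeasurable_Fvol.mul (aemeasurable_gSpeedOn γ)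

lemma MemRh.numH_nonneg (hcn : 0 < cn) (h : MemRh n cn x0 y0 γ) (w : ℝ → ℝ) {t : ℝ}
    (ht : t ∈ Ioo (0 : ℝ) 1) : 0 ≤ numH n cn p 0 1 (Ico 0 1) γ w t :=
  mul_nonneg (mul_nonneg (Real.rpow_nonneg (abs_nonneg _) _)
    (Real.rpow_nonneg (Fvol_pos hcn (h.2.1 t ⟨ht.1.le, ht.2⟩)).le _))
    (Real.rpow_nonneg (h.hSpeedOn_nonneg hcn ht) _)

lemma MemRh.denH_nonneg (hcn : 0 < cn) (h : MemRh n cn x0 y0 γ) (w : ℝ → ℝ) {t : ℝ}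
    (ht : t ∈ Ioo (0 : ℝ) 1) : 0 ≤ denH n cn p (Ico 0 1) γ w t :=
  mul_nonneg (Real.rpow_nonneg (abs_nonneg _) _) (h.hSpeedOn_nonneg hcn ht)

lemma MemRh.aemeasurable_numH (h : MemRh n cn x0 y0 γ) (p : ℝ) (w : ℝ → ℝ) :
    AEMeasurable (numH n cn p 0 1 (Ico 0 1) γ w) (volume.restrict (Ioo 0 1)) := by
  have hw : AEMeasurable (derivWithin w (Icc 0 1)) (volume.restrict (Ioo 0 1)) :=
    (measurable_deriv w).aemeasurable.congr (ae_restrict_of_forall_mem measurableSet_Ioo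
      fun t ht => (derivWithin_of_mem_nhds (Icc_mem_nhds ht.1 ht.2)).symm)
  exact ((hw.abs.pow_const p).mul (h.aemeasurable_Fvol.pow_const p)).mul
    (h.aemeasurable_hSpeedOn.pow_const (1 - p))

/-- The denominator integrand is integrable for continuous test functions. -/
lemma MemRh.integrableOn_denH (hcn : 0 < cn) (h : MemRh n cn x0 y0 γ) (hp : 0 ≤ p)
    (hw : ContinuousOn w (Icc 0 1)) : IntegrableOn (denH n cn p (Ico 0 1) γ w) (Ioo 0 1) := by
  obtain ⟨M, hM⟩ := h.2.2.2.1
  obtain ⟨C, hC⟩ := isCompact_Icc.exists_bound_of_continuousOn hw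
  have hmeas : AEMeasurable (denH n cn p (Ico 0 1) γ w) (volume.restrict (Ioo 0 1)) :=
    (((hw.mono Ioo_subset_Icc_self).aemeasurable measurableSet_Ioo).abs.pow_const p).mul
      h.aemeasurable_hSpeedOn
  refine Integrable.of_bound hmeas.aestronglyMeasurable (C ^ p * M) ?_
  filter_upwards [ae_restrict_of_ae hM, ae_restrict_mem measurableSet_Ioo] with t htM ht
  rw [Real.norm_of_nonneg (h.denH_nonneg hcn w ht)]
  exact mul_le_mul (Real.rpow_le_rpow (abs_nonneg _) (hC t (Ioo_subset_Icc_self ht)) hp)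
    (htM ⟨ht.1.le, ht.2⟩) (h.hSpeedOn_nonneg hcn ht)
    (Real.rpow_nonneg ((abs_nonneg _).trans (hC t (Ioo_subset_Icc_self ht))) _)

lemma intervalIntegrable_iff_integrableOn_Ioo_zero_one {f : ℝ → ℝ} :
    IntervalIntegrable f volume 0 1 ↔ IntegrableOn f (Ioo 0 1) :=
  intervalIntegrable_iff_integrableOn_Ioo_of_le zero_le_one

lemma intervalIntegral_eq_integral_Ioo_zero_one (f : ℝ → ℝ) :
    ∫ t in (0 : ℝ)..1, f t = ∫ t in Ioo 0 1, f t := by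
  rw [intervalIntegral.integral_of_le zero_le_one, integral_Ioc_eq_integral_Ioo]

/-- A nonnegative bounded density on `[0,1]` which vanishes a.e. where its own primitive does not
vanishes a.e. -/
lemma ae_eq_zero_of_mul_primitive_eq_zero {φ : ℝ → ℝ} (hφ : Measurable φ)
    (hφ0 : ∀ t, 0 ≤ φ t) (hφ1 : ∀ t, φ t ≤ 1)
    (h : ∀ᵐ t ∂volume.restrict (Ioo (0 : ℝ) 1), (∫ s in (0 : ℝ)..t, φ s) * φ t = 0) :
    ∀ᵐ t ∂volume.restrict (Ioo (0 : ℝ) 1), φ t = 0 := by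
  have hint : ∀ a b, IntervalIntegrable φ volume a b := fun a b =>
    (intervalIntegrable_const (c := (1 : ℝ))).mono_fun hφ.aestronglyMeasurable
      (Eventually.of_forall fun t => by simpa [abs_of_nonneg (hφ0 t)] using hφ1 t)
  have hac : AbsolutelyContinuousOnInterval (fun t => ∫ s in (0 : ℝ)..t, φ s) 0 1 :=
    (hint 0 1).absolutelyContinuousOnInterval_intervalIntegral (by simp)
  have hprod := hac.integral_deriv_mul_eq_sub hac
  have hzero : ∫ x in (0 : ℝ)..1, deriv (fun t => ∫ s in (0 : ℝ)..t, φ s) x *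
      (∫ s in (0 : ℝ)..x, φ s) + (∫ s in (0 : ℝ)..x, φ s) *
        deriv (fun t => ∫ s in (0 : ℝ)..t, φ s) x = 0 := by
    rw [intervalIntegral_eq_integral_Ioo_zero_one]
    refine integral_eq_zero_of_ae ?_
    filter_upwards [h, ae_restrict_of_ae (hint 0 1).ae_hasDerivAt_integral,
      ae_restrict_mem measurableSet_Ioo] with t h1 h2 ht
    have hd := h2 (by rw [uIcc_of_le zero_le_one]; exact Ioo_subset_Icc_self ht) 0 (by simp)
    rw [hd.deriv]
    simp only [Pi.zero_apply]
    linarith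
  rw [hzero] at hprod
  have h1 : ∫ s in (0 : ℝ)..1, φ s = 0 := by
    simp only [intervalIntegral.integral_same, mul_zero, sub_zero] at hprod
    exact mul_self_eq_zero.1 hprod.symm
  rw [intervalIntegral_eq_integral_Ioo_zero_one] at h1
  exact (integral_eq_zero_iff_of_nonneg hφ0
    (intervalIntegrable_iff_integrableOn_Ioo_zero_one.1 (hint 0 1))).1 h1

/-- The set of admissible Rayleigh quotients is nonempty as soon as the curve is not stationary. -/
lemma MemRh.rayleigh_nonempty (hcn : 0 < cn) (h : MemRh n cn x0 y0 γ) (hp : 1 < p)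
    (hspeed : ¬ ∀ᵐ t ∂volume.restrict (Ioo (0 : ℝ) 1), hSpeedOn n cn (Ico 0 1) γ t = 0) :
    ∃ w : ℝ → ℝ, (∃ K, LipschitzOnWith K w (Icc 0 1)) ∧ w 0 = 0 ∧
      IntervalIntegrable (numH n cn p 0 1 (Ico 0 1) γ w) volume 0 1 ∧
      IntervalIntegrable (denH n cn p (Ico 0 1) γ w) volume 0 1 ∧
      0 < ∫ t in (0:ℝ)..1, denH n cn p (Ico 0 1) γ w t := by
  set φ : ℝ → ℝ := fun t =>
    min 1 (√((deriv (fun u => (γ u).1) t) ^ 2 + (deriv (fun u => (γ u).2) t) ^ 2))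
  have hφ : Measurable φ := measurable_const.min
    (((measurable_deriv _).pow_const 2).add ((measurable_deriv _).pow_const 2)).sqrt
  have hφ0 : ∀ t, 0 ≤ φ t := fun t => le_min zero_le_one (Real.sqrt_nonneg _)
  have hφ1 : ∀ t, φ t ≤ 1 := fun t => min_le_left _ _
  have hφg : ∀ t ∈ Ioo (0 : ℝ) 1, φ t = min 1 (gSpeedOn (Ico 0 1) γ t) := fun t ht => by
    rw [gSpeedOn_Ico_eq ht]
  have hint : ∀ a b, IntervalIntegrable φ volume a b := fun a b =>
    (intervalIntegrable_const (c := (1 : ℝ))).mono_fun hφ.aestronglyMeasurable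
      (Eventually.of_forall fun t => by simpa [abs_of_nonneg (hφ0 t)] using hφ1 t)
  set w : ℝ → ℝ := fun t => ∫ s in (0 : ℝ)..t, φ s with hw
  have hLip : LipschitzWith 1 w := by
    refine LipschitzWith.of_dist_le_mul fun a b => ?_
    rw [Real.dist_eq, hw]
    simp only
    rw [intervalIntegral.integral_interval_sub_left (hint _ _) (hint _ _), Real.dist_eq]
    have := intervalIntegral.norm_integral_le_of_norm_le_const (f := φ) (a := b) (b := a) (C := 1)
      fun t _ => by rw [Real.norm_of_nonneg (hφ0 t)]; exact hφ1 t
    simpa using this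
  have hden := h.integrableOn_denH hcn (p := p) (by linarith) hLip.continuous.continuousOn
  refine ⟨w, ⟨1, hLip.lipschitzOnWith⟩, by simp [hw], ?_,
    intervalIntegrable_iff_integrableOn_Ioo_zero_one.2 hden, ?_⟩
  · rw [intervalIntegrable_iff_integrableOn_Ioo_zero_one]
    obtain ⟨M, hM⟩ := h.2.2.2.1
    refine Integrable.of_bound (h.aemeasurable_numH p w).aestronglyMeasurable M ?_
    filter_upwards [ae_restrict_of_ae hM, ae_restrict_mem measurableSet_Ioo,
      ae_restrict_of_ae (hint 0 1).ae_hasDerivAt_integral] with t htM ht hd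
    have hd := hd (by rw [uIcc_of_le zero_le_one]; exact Ioo_subset_Icc_self ht) 0 (by simp)
    rw [Real.norm_of_nonneg (h.numH_nonneg hcn w ht)]
    refine le_trans ?_ (htM ⟨ht.1.le, ht.2⟩)
    have hF := Fvol_pos (n := n) hcn (h.2.1 t ⟨ht.1.le, ht.2⟩)
    have hg := gSpeedOn_nonneg (Ico 0 1) γ t
    simp only [numH, hSpeed]
    rw [derivWithin_of_mem_nhds (Icc_mem_nhds ht.1 ht.2), hd.deriv, abs_of_nonneg (hφ0 t)]
    calc φ t ^ p * Fvol n cn (γ t) ^ p * hSpeedOn n cn (Ico 0 1) γ t ^ (1 - p)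
        ≤ gSpeedOn (Ico 0 1) γ t ^ p * Fvol n cn (γ t) ^ p *
            hSpeedOn n cn (Ico 0 1) γ t ^ (1 - p) := by
          gcongr
          · exact Real.rpow_nonneg (h.hSpeedOn_nonneg hcn ht) _
          · rw [hφg t ht]; exact min_le_right _ _
      _ = hSpeedOn n cn (Ico 0 1) γ t := by
          rw [← Real.mul_rpow hg hF.le, mul_comm (gSpeedOn _ _ _)]
          change hSpeedOn n cn (Ico 0 1) γ t ^ p * _ = _
          rcases (h.hSpeedOn_nonneg hcn ht).eq_or_lt with h0 | h0
          · rw [← h0, Real.zero_rpow (by linarith), zero_mul]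
          · rw [← Real.rpow_add h0]; simp
  · rw [intervalIntegral_eq_integral_Ioo_zero_one]
    have hnn : 0 ≤ᵐ[volume.restrict (Ioo (0 : ℝ) 1)] denH n cn p (Ico 0 1) γ w :=
      ae_restrict_of_forall_mem measurableSet_Ioo fun t ht => h.denH_nonneg hcn w ht
    refine (integral_nonneg_of_ae hnn).lt_of_ne fun h0 => hspeed ?_
    have hz := (integral_eq_zero_iff_of_nonneg_ae hnn hden).1 h0.symm
    have hz' := ae_eq_zero_of_mul_primitive_eq_zero hφ hφ0 hφ1 (by
      filter_upwards [hz, ae_restrict_mem measurableSet_Ioo] with t hzt ht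
      rcases mul_eq_zero.1 hzt with hwt | hht
      · have hwt0 : w t = 0 :=
          abs_eq_zero.1 ((Real.rpow_eq_zero (abs_nonneg _) (by linarith)).1 hwt)
        exact mul_eq_zero_of_left hwt0 _
      · have hF := Fvol_pos (n := n) hcn (h.2.1 t ⟨ht.1.le, ht.2⟩)
        rw [hφg t ht, (mul_eq_zero.1 hht).resolve_left hF.ne']
        simp)
    filter_upwards [hz', ae_restrict_mem measurableSet_Ioo] with t hzt ht
    rw [hφg t ht] at hzt
    have hg0 : gSpeedOn (Ico 0 1) γ t = 0 := by
      rcases min_choice 1 (gSpeedOn (Ico 0 1) γ t) with hm | hm <;> rw [hm] at hzt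
      · exact absurd hzt one_ne_zero
      · exact hzt
    rw [hSpeedOn, hg0, mul_zero]

/-- If the `h`-volume factor and `h`-speed of one curve are a.e. obtained from those of another by
multiplying with `m ^ (2n-2)` and `m ^ (2n-1)`, where `0 < m ≤ 1`, then its eigenvalue is larger
for `p ≥ 2n-1`. -/
lemma lambdaH_le_of_scaling {α β : ℝ → ℝ × ℝ} {m : ℝ → ℝ} (hn : 2 ≤ n) (hcn : 0 < cn)
    (hα : MemRh n cn x0 y0 α) (hβ : MemRh n cn x0 y0 β)
    (hm0 : ∀ t, 0 < m t) (hm1 : ∀ t, m t ≤ 1)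
    (hF : ∀ t, Fvol n cn (β t) = m t ^ (2 * (n - 1)) * Fvol n cn (α t))
    (hg : ∀ᵐ t, t ∈ Ioo (0 : ℝ) 1 →
      gSpeedOn (Ico 0 1) β t = m t * gSpeedOn (Ico 0 1) α t)
    (hp : 2 * (n : ℝ) - 1 ≤ p) : lambdaH n cn p α ≤ lambdaH n cn p β := by
  have hn' : (2 : ℝ) ≤ n := by exact_mod_cast hn
  have hp1 : 1 < p := by linarith
  have hh : ∀ᵐ t ∂volume.restrict (Ioo (0 : ℝ) 1), hSpeedOn n cn (Ico 0 1) β t =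
      m t ^ (2 * (n - 1) + 1) * hSpeedOn n cn (Ico 0 1) α t := by
    filter_upwards [ae_restrict_of_ae hg, ae_restrict_mem measurableSet_Ioo] with t h1 ht
    rw [hSpeedOn, hSpeedOn, hF, h1 ht, pow_succ]
    ring
  have hnum : ∀ w, numH n cn p 0 1 (Ico 0 1) α w ≤ᵐ[volume.restrict (Ioo (0 : ℝ) 1)]
      numH n cn p 0 1 (Ico 0 1) β w := fun w => by
    filter_upwards [hh, ae_restrict_mem measurableSet_Ioo] with t ht1 ht
    have hFα := Fvol_pos (n := n) hcn (hα.2.1 t ⟨ht.1.le, ht.2⟩)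
    have hsα := hα.hSpeedOn_nonneg hcn ht
    have hm := hm0 t
    have hnn := hα.numH_nonneg hcn (p := p) w ht
    have hpow : (m t ^ (2 * (n - 1))) ^ p * (m t ^ (2 * (n - 1) + 1)) ^ (1 - p) =
        m t ^ (2 * (n : ℝ) - 1 - p) := by
      rw [← Real.rpow_natCast, ← Real.rpow_natCast, ← Real.rpow_mul hm.le, ← Real.rpow_mul hm.le,
        ← Real.rpow_add hm]
      congr 1
      push_cast [Nat.cast_sub (by omega : 1 ≤ n)]
      ring
    have heq : numH n cn p 0 1 (Ico 0 1) β w t =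
        m t ^ (2 * (n : ℝ) - 1 - p) * numH n cn p 0 1 (Ico 0 1) α w t := by
      simp only [numH]
      rw [ht1, hF, Real.mul_rpow (by positivity) hFα.le, Real.mul_rpow (by positivity) hsα, ← hpow]
      ring
    rw [heq]
    exact le_mul_of_one_le_left hnn
      (Real.one_le_rpow_of_pos_of_le_one_of_nonpos hm (hm1 t) (by linarith))
  have hden : ∀ w, denH n cn p (Ico 0 1) β w ≤ᵐ[volume.restrict (Ioo (0 : ℝ) 1)]
      denH n cn p (Ico 0 1) α w := fun w => by
    filter_upwards [hh, ae_restrict_mem measurableSet_Ioo] with t ht1 ht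
    refine mul_le_mul_of_nonneg_left ?_ (Real.rpow_nonneg (abs_nonneg _) _)
    rw [ht1]
    exact mul_le_of_le_one_left (hα.hSpeedOn_nonneg hcn ht) (pow_le_one₀ (hm0 t).le (hm1 t))
  have hnum0 : ∀ w, 0 ≤ ∫ t in (0 : ℝ)..1, numH n cn p 0 1 (Ico 0 1) α w t := fun w => by
    rw [intervalIntegral_eq_integral_Ioo_zero_one]
    exact setIntegral_nonneg measurableSet_Ioo fun t ht => hα.numH_nonneg hcn w ht
  unfold lambdaH lambdaHOn
  by_cases hne : ∃ w : ℝ → ℝ, (∃ K, LipschitzOnWith K w (Icc 0 1)) ∧ w 0 = 0 ∧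
      IntervalIntegrable (numH n cn p 0 1 (Ico 0 1) β w) volume 0 1 ∧
      IntervalIntegrable (denH n cn p (Ico 0 1) β w) volume 0 1 ∧
      0 < ∫ t in (0:ℝ)..1, denH n cn p (Ico 0 1) β w t
  · obtain ⟨w₀, h1, h2, h3, h4, h5⟩ := hne
    refine le_csInf ⟨_, w₀, h1, h2, h3, h4, h5, rfl⟩ ?_
    rintro q ⟨w, ⟨K, hK⟩, hw0, hwn, hwd, hpos, rfl⟩
    have hIn := intervalIntegrable_iff_integrableOn_Ioo_zero_one.1 hwn
    have hId := intervalIntegrable_iff_integrableOn_Ioo_zero_one.1 hwd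
    have hIdα := hα.integrableOn_denH hcn (p := p) (by linarith) hK.continuousOn
    have hInα : IntegrableOn (numH n cn p 0 1 (Ico 0 1) α w) (Ioo 0 1) := by
      refine Integrable.mono' hIn (hα.aemeasurable_numH p w).aestronglyMeasurable ?_
      filter_upwards [hnum w, ae_restrict_mem measurableSet_Ioo] with t h6 ht
      rwa [Real.norm_of_nonneg (hα.numH_nonneg hcn w ht)]
    have hle1 := integral_mono_ae hInα hIn (hnum w)
    have hle2 := integral_mono_ae hId hIdα (hden w)
    rw [← intervalIntegral_eq_integral_Ioo_zero_one,
      ← intervalIntegral_eq_integral_Ioo_zero_one] at hle1 hle2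
    refine le_trans (csInf_le ⟨0, ?_⟩ ⟨w, ⟨K, hK⟩, hw0,
      intervalIntegrable_iff_integrableOn_Ioo_zero_one.2 hInα,
      intervalIntegrable_iff_integrableOn_Ioo_zero_one.2 hIdα, hpos.trans_le hle2, rfl⟩)
      (div_le_div₀ ((hnum0 w).trans hle1) hle1 hpos hle2)
    rintro q ⟨v, -, -, -, -, hv, rfl⟩
    exact div_nonneg (hnum0 v) hv.le
  · have hstat : ∀ᵐ t ∂volume.restrict (Ioo (0 : ℝ) 1), hSpeedOn n cn (Ico 0 1) β t = 0 :=
      by_contra fun hs => hne (hβ.rayleigh_nonempty hcn hp1 hs)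
    have hdenα : ∀ w, ∫ t in (0 : ℝ)..1, denH n cn p (Ico 0 1) α w t = 0 := fun w => by
      rw [intervalIntegral_eq_integral_Ioo_zero_one]
      refine integral_eq_zero_of_ae ?_
      filter_upwards [hh, hstat] with t h1 h2
      rw [h2] at h1
      have := (mul_eq_zero.1 h1.symm).resolve_left (pow_pos (hm0 t) _).ne'
      simp [denH, this]
    refine le_trans (le_of_eq ?_) (Real.sInf_nonneg ?_)
    · convert Real.sInf_empty
      refine eq_empty_of_forall_notMem ?_
      rintro q ⟨w, -, -, -, -, hpos, -⟩
      exact hpos.ne' (hdenα w)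
    · rintro q ⟨w, hK, hw0, hwn, hwd, hpos, -⟩
      exact absurd ⟨w, hK, hw0, hwn, hwd, hpos⟩ hne

end Rayleigh

/-- Folding a curve of class `R_h` into the disc through its starting point stays in `R_h`. -/
lemma MemRh.discFold {n : ℕ} {cn x0 y0 : ℝ} {α : ℝ → ℝ × ℝ} (hcn : 0 < cn)
    (hS : 0 < x0 ^ 2 + y0 ^ 2) (hα : MemRh n cn x0 y0 α) :
    MemRh n cn x0 y0 (fun t => discFold (x0 ^ 2 + y0 ^ 2) (α t)) := by
  have hα' := hα
  obtain ⟨h0, hint, hlip, ⟨M, hM⟩, hlim⟩ := hα'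
  refine ⟨?_, fun t ht => discFold_mem_Pint hS (hint t ht), fun a ha => ?_, ⟨M, ?_⟩, ?_⟩
  · simp only [h0]
    exact discFold_of_le hS le_rfl
  · obtain ⟨K, hK⟩ := hlip a ha
    exact ⟨2 * K, lipschitzOnWith_discFold_comp hS hK⟩
  · have hne : ∀ᵐ t : ℝ, t ≠ 0 := by simp [ae_iff, measure_singleton]
    filter_upwards [hM, ae_gSpeedOn_discFold hS hlip, hne] with t h1 h2 hne ht
    have hmem : t ∈ Ioo (0 : ℝ) 1 := ⟨lt_of_le_of_ne ht.1 hne.symm, ht.2⟩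
    refine le_trans ?_ (h1 ht)
    have hm0 := (foldFactor_pos hS (α t)).le
    have hm1 := foldFactor_le_one hS (α t)
    simp only [hSpeed]
    have hF := (Fvol_pos (n := n) hcn (hint t ht)).le
    rw [hSpeedOn, h2 hmem, Fvol_discFold]
    exact mul_le_mul (mul_le_of_le_one_left hF (pow_le_one₀ hm0 hm1))
      (mul_le_of_le_one_left (gSpeedOn_nonneg _ _ _) hm1)
      (mul_nonneg hm0 (gSpeedOn_nonneg _ _ _)) hF
  · have hev : ∀ᶠ t in 𝓝[<] (1 : ℝ), t ∈ Ioo (0 : ℝ) 1 := Ioo_mem_nhdsLT zero_lt_one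
    refine tendsto_of_tendsto_of_tendsto_of_le_of_le' tendsto_const_nhds hlim ?_ ?_
    · filter_upwards [hev] with t ht
      have := discFold_mem_Pint hS (hint t ⟨ht.1.le, ht.2⟩)
      exact mul_nonneg this.1.le this.2.le
    · filter_upwards [hev] with t ht
      have hz := hint t ⟨ht.1.le, ht.2⟩
      have hm0 := (foldFactor_pos hS (α t)).le
      have hm1 := foldFactor_le_one hS (α t)
      exact mul_le_mul (mul_le_of_le_one_left hz.1.le hm1) (mul_le_of_le_one_left hz.2.le hm1)
        (mul_nonneg hm0 hz.2.le) hz.1.le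

/-- Any `α ∈ R_h` can be replaced by `β ∈ R_h` whose image lies
in `K = {(x,y) ∈ P : x² + y² ≤ x₀² + y₀²}` and with `λ_{1,p}(β) ≥ λ_{1,p}(α)`
for all `p ≥ 2n-1`. -/
theorem simons_stmt6 (n : ℕ) (hn : 2 ≤ n) (cn : ℝ) (hcn : 0 < cn)
    (x0 y0 : ℝ) (hy0 : 0 < y0) (hxy : y0 ≤ x0)
    (α : ℝ → ℝ × ℝ) (hα : MemRh n cn x0 y0 α) :
    ∃ β : ℝ → ℝ × ℝ, MemRh n cn x0 y0 β ∧
      (∀ t ∈ Ico (0:ℝ) 1, β t ∈ Pset ∧ (β t).1 ^ 2 + (β t).2 ^ 2 ≤ x0 ^ 2 + y0 ^ 2) ∧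
      ∀ p : ℝ, 2 * (n : ℝ) - 1 ≤ p → lambdaH n cn p α ≤ lambdaH n cn p β := by
  have hS : 0 < x0 ^ 2 + y0 ^ 2 := by positivity
  have hβ := hα.discFold hcn hS
  refine ⟨_, hβ, fun t ht => ⟨?_, discFold_mem_disc hS _⟩, fun p hp => ?_⟩
  · exact ⟨(hβ.2.1 t ht).1.le, (hβ.2.1 t ht).2.le⟩
  · exact lambdaH_le_of_scaling hn hcn hα hβ (fun t => foldFactor_pos hS (α t))
      (fun t => foldFactor_le_one hS (α t)) (fun t => Fvol_discFold n cn (α t))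
      (ae_gSpeedOn_discFold hS hα.2.2.1) hp
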